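/- arXiv:2507.02930 — 5 statements merged into one kernel-verified Lean document; each statement's English description precedes it below -/
import Mathlib

section
/- Let n be an odd, squarefree, composite integer with n ≥ 4 such that φ(n) − 1 = 3 · ∏_{p ∣ n} (p − 2), where the product runs over the distinct prime divisors of n and φ is Euler's totient function. Then every prime divisor p of n satisfies p ≡ 2 (mod 3). -/
theorem stmt_0 (n : ℕ) (hodd : Odd n) (hsqf : Squarefree n) (hcomp : ¬ n.Prime)
    (hn : 4 ≤ n)
    (h : Nat.totient n - 1 = 3 * ∏ p ∈ n.primeFactors, (p - 2)) :
    ∀ p : ℕ, p.Prime → p ∣ n → p % 3 = 2 := by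
  have hφ : n.totient % 3 = 1 := by
    have hpos : 0 < n.totient := Nat.totient_pos.mpr (by omega)
    omega
  have hprod : n.totient = ∏ p ∈ n.primeFactors, (p - 1) := by
    rw [Nat.totient_eq_prod_factorization (by omega), Finsupp.prod, Nat.support_factorization]
    refine Finset.prod_congr rfl fun p hp => ?_
    rw [Nat.factorization_eq_one_of_squarefree hsqf (Nat.prime_of_mem_primeFactors hp)
      (Nat.dvd_of_mem_primeFactors hp)]
    simp
  have hne_one : ∀ p ∈ n.primeFactors, p % 3 ≠ 1 := by
    intro p hp hmod
    have hdvd : p - 1 ∣ n.totient := hprod ▸ Finset.dvd_prod_of_mem (fun q => q - 1) hp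
    have hthree : 3 ∣ n.totient := (show 3 ∣ p - 1 by omega).trans hdvd
    omega
  have hmod_two : ∀ p ∈ n.primeFactors, p ≠ 3 → p % 3 = 2 := by
    intro p hp hp3
    have hndvd : ¬ 3 ∣ p := fun hd =>
      hp3 ((Nat.prime_dvd_prime_iff_eq Nat.prime_three (Nat.prime_of_mem_primeFactors hp)).mp hd).symm
    have := hne_one p hp
    omega
  have hthree : 3 ∉ n.primeFactors := by
    intro hmem
    have hrest : (∏ p ∈ n.primeFactors.erase 3, (p - 1)) % 3 = 1 := by
      refine Finset.prod_induction (fun p => p - 1) (fun a => a % 3 = 1)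
        (fun a b ha hb => by simp [Nat.mul_mod, ha, hb]) rfl fun p hp => ?_
      have := hmod_two p (Finset.mem_of_mem_erase hp) (Finset.ne_of_mem_erase hp)
      show (p - 1) % 3 = 1
      omega
    rw [← Finset.mul_prod_erase _ _ hmem] at hprod
    omega
  intro p hp hpn
  have hmem : p ∈ n.primeFactors := Nat.mem_primeFactors.mpr ⟨hp, hpn, by omega⟩
  exact hmod_two p hmem fun h3 => hthree (h3 ▸ hmem)
end

section
/- Let n be an odd, squarefree, composite integer with n ≥ 4 such that φ(n) − 1 = 3 · ∏_{p ∣ n} (p − 2), where the product runs over the distinct prime divisors of n and φ is Euler's totient function. Then the number of distinct prime divisors of n is at least 48, i.e., ω(n) ≥ 48. -/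
theorem Finset.prod_le_prod_range_card_of_antitone {f : ℕ → ℚ} (hf : Antitone f)
    (hpos : ∀ k, 0 ≤ f k) (T : Finset ℕ) :
    ∏ k ∈ T, f k ≤ ∏ k ∈ Finset.range T.card, f k := by
  induction T using Finset.induction_on_max with
  | empty => simp
  | insert a s hs ih =>
    have ha : a ∉ s := fun h => lt_irrefl _ (hs a h)
    have hcard : s.card ≤ a := by
      have hsub : s ⊆ Finset.range a := fun x hx => Finset.mem_range.2 (hs x hx)
      simpa using Finset.card_le_card hsub
    rw [Finset.prod_insert ha, Finset.card_insert_of_notMem ha, Finset.prod_range_succ, mul_comm]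
    exact mul_le_mul ih (hf hcard) (hpos a) (Finset.prod_nonneg fun k _ => hpos k)

theorem Nat.totient_eq_prod_of_squarefree {n : ℕ} (hsqf : Squarefree n) :
    Nat.totient n = ∏ p ∈ n.primeFactors, (p - 1) := by
  have h := Nat.totient_mul_prod_primeFactors n
  rw [Nat.prod_primeFactors_of_squarefree hsqf, mul_comm] at h
  exact Nat.eq_of_mul_eq_mul_left (Nat.pos_of_ne_zero hsqf.ne_zero) h

/-- A prime congruent to `1` modulo `3` cannot divide a number whose totient is `1` modulo `3`,
and then `3` itself is excluded because it would contribute a factor `2`. -/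
theorem Nat.mod_three_eq_two_of_totient_mod_three {n : ℕ} (hsqf : Squarefree n)
    (h : Nat.totient n % 3 = 1) : ∀ p ∈ n.primeFactors, p % 3 = 2 := by
  rw [Nat.totient_eq_prod_of_squarefree hsqf] at h
  have hone : ∀ p ∈ n.primeFactors, p % 3 ≠ 1 := by
    intro p hp hp1
    have hdvd : p - 1 ∣ ∏ p ∈ n.primeFactors, (p - 1) := Finset.dvd_prod_of_mem _ hp
    have h3 : 3 ∣ ∏ p ∈ n.primeFactors, (p - 1) := dvd_trans (by omega) hdvd
    omega
  have hthree : 3 ∉ n.primeFactors := by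
    intro hmem
    have hrest : (∏ p ∈ n.primeFactors.erase 3, (p - 1)) ≡ 1 [MOD 3] := by
      refine Finset.prod_induction _ (· ≡ 1 [MOD 3]) (fun a b ha hb => ha.mul hb) rfl ?_
      intro p hp
      obtain ⟨hp3, hp⟩ := Finset.mem_erase.1 hp
      have hprime := Nat.prime_of_mem_primeFactors hp
      have h0 : p % 3 ≠ 0 := fun h0 =>
        hp3 ((Nat.prime_dvd_prime_iff_eq Nat.prime_three hprime).1 (Nat.dvd_of_mod_eq_zero h0)).symm
      have h1 := hone p hp
      change (p - 1) % 3 = 1 % 3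
      omega
    rw [← Finset.mul_prod_erase _ _ hmem] at h
    change _ % 3 = 1 % 3 at hrest
    omega
  intro p hp
  have hprime := Nat.prime_of_mem_primeFactors hp
  have h0 : p % 3 ≠ 0 := fun h0 => hthree
    ((Nat.prime_dvd_prime_iff_eq Nat.prime_three hprime).1 (Nat.dvd_of_mod_eq_zero h0) ▸ hp)
  have h1 := hone p hp
  omega

theorem antitone_add_four_div_add_three :
    Antitone fun k : ℕ => (6 * k + 4 : ℚ) / (6 * k + 3) := by
  intro a b hab
  have hab' : (a : ℚ) ≤ b := by exact_mod_cast hab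
  have ha : (0 : ℚ) ≤ a := a.cast_nonneg
  change (6 * b + 4 : ℚ) / (6 * b + 3) ≤ (6 * a + 4) / (6 * a + 3)
  rw [div_le_div_iff₀ (by linarith) (by linarith)]
  nlinarith

theorem prod_sub_one_div_sub_two_le {S : Finset ℕ} (hS : ∀ p ∈ S, p % 6 = 5) :
    ∏ p ∈ S, (((p - 1 : ℕ) : ℚ) / ((p - 2 : ℕ) : ℚ)) ≤
      ∏ k ∈ Finset.range S.card, (6 * k + 4 : ℚ) / (6 * k + 3) := by
  have hinj : Set.InjOn (· / 6) (S : Set ℕ) := by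
    intro a ha b hb hab
    have h1 := hS a ha
    have h2 := hS b hb
    change a / 6 = b / 6 at hab
    omega
  have hle := Finset.prod_le_prod_range_card_of_antitone antitone_add_four_div_add_three
    (fun k => by positivity) (S.image (· / 6))
  rw [Finset.card_image_of_injOn hinj, Finset.prod_image hinj] at hle
  refine le_of_eq_of_le (Finset.prod_congr rfl fun p hp => ?_) hle
  have h5 := hS p hp
  have h1 : p - 1 = 6 * (p / 6) + 4 := by omega
  have h2 : p - 2 = 6 * (p / 6) + 3 := by omega
  rw [h1, h2]
  push_cast
  rfl

theorem stmt_1 (n : ℕ) (hodd : Odd n) (hsqf : Squarefree n) (hcomp : ¬ n.Prime)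
    (hn : 4 ≤ n)
    (h : Nat.totient n - 1 = 3 * ∏ p ∈ n.primeFactors, (p - 2)) :
    48 ≤ n.primeFactors.card := by
  by_contra! hcard
  have hpos : 0 < Nat.totient n := Nat.totient_pos.2 (by omega)
  have h' : Nat.totient n = 3 * ∏ p ∈ n.primeFactors, (p - 2) + 1 := by omega
  have hmod : ∀ p ∈ n.primeFactors, p % 6 = 5 := by
    intro p hp
    have h3 := Nat.mod_three_eq_two_of_totient_mod_three hsqf (by omega) p hp
    have h2 := Nat.odd_iff.1 (hodd.of_dvd_nat (Nat.dvd_of_mem_primeFactors hp))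
    omega
  have hle := prod_sub_one_div_sub_two_le hmod
  have hmono : ∏ k ∈ Finset.range n.primeFactors.card, (6 * k + 4 : ℚ) / (6 * k + 3) ≤
      ∏ k ∈ Finset.range 47, (6 * k + 4 : ℚ) / (6 * k + 3) := by
    refine Finset.prod_le_prod_of_subset_of_one_le
      (Finset.range_mono (by omega)) (fun k _ => by positivity) (fun k _ _ => ?_)
    rw [one_le_div (by positivity)]
    linarith
  have hlt : ∏ k ∈ Finset.range 47, (6 * k + 4 : ℚ) / (6 * k + 3) < 3 := by
    norm_num [Finset.prod_range_succ]
  have hS : (0 : ℚ) < ∏ p ∈ n.primeFactors, ((p - 2 : ℕ) : ℚ) :=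
    Finset.prod_pos fun p hp => by
      have := hmod p hp
      exact_mod_cast (by omega : 0 < p - 2)
  have hratio := (hle.trans hmono).trans_lt hlt
  rw [Finset.prod_div_distrib, div_lt_iff₀ hS] at hratio
  rw [Nat.totient_eq_prod_of_squarefree hsqf] at h'
  have : ∏ p ∈ n.primeFactors, (p - 1) < 3 * ∏ p ∈ n.primeFactors, (p - 2) := by
    exact_mod_cast hratio
  omega
end

section
/- Let n be an odd, squarefree, composite integer with n ≥ 4 such that (∏_{p ∣ n} (p − 2)) divides φ(n) − 1, where the product runs over the distinct prime divisors of n and φ is Euler's totient function, and assume (φ(n) − 1)/∏_{p ∣ n}(p − 2) ≥ 3. If every prime divisor of n is greater than or equal to 11, then ω(n) ≥ p*, where p* is the smallest prime divisor of n and ω(n) denotes the number of distinct prime divisors of n. -/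
/-- For distinct integers `q ≥ b + 2`, the product of the ratios `(q - 1) / (q - 2)` is at most the
telescoping product over the consecutive integers starting at `b + 2`. -/
theorem mul_prod_sub_one_le_add_card_mul_prod_sub_two (b : ℕ) (s : Finset ℕ)
    (hs : ∀ q ∈ s, b + 2 ≤ q) :
    b * ∏ q ∈ s, (q - 1) ≤ (b + s.card) * ∏ q ∈ s, (q - 2) := by
  induction s using Finset.induction_on_max with
  | empty => simp
  | insert m s hlt ih =>
    have hm : m ∉ s := fun h => lt_irrefl m (hlt m h)
    have hcard : b + 2 + s.card ≤ m := by
      have hsub : s ⊆ Finset.Ico (b + 2) m := fun q hq =>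
        Finset.mem_Ico.2 ⟨hs q (Finset.mem_insert_of_mem hq), hlt q hq⟩
      have hle := Finset.card_le_card hsub
      rw [Nat.card_Ico] at hle
      have := hs m (Finset.mem_insert_self m s)
      omega
    have ih := ih fun q hq => hs q (Finset.mem_insert_of_mem hq)
    rw [Finset.prod_insert hm, Finset.prod_insert hm, Finset.card_insert_of_notMem hm]
    obtain ⟨r, rfl⟩ : ∃ r, m = r + 2 := ⟨m - 2, by omega⟩
    have hr : b + s.card ≤ r := by omega
    rw [show r + 2 - 1 = r + 1 by omega, Nat.add_sub_cancel]
    calc b * ((r + 1) * ∏ q ∈ s, (q - 1)) = (r + 1) * (b * ∏ q ∈ s, (q - 1)) := by ring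
      _ ≤ (r + 1) * ((b + s.card) * ∏ q ∈ s, (q - 2)) := by gcongr
      _ = ((r + 1) * (b + s.card)) * ∏ q ∈ s, (q - 2) := by ring
      _ ≤ ((b + (s.card + 1)) * r) * ∏ q ∈ s, (q - 2) := by
        gcongr ?_ * _
        nlinarith
      _ = (b + (s.card + 1)) * (r * ∏ q ∈ s, (q - 2)) := by ring

theorem Squarefree.totient_eq_prod_primeFactors {n : ℕ} (hn : Squarefree n) :
    Nat.totient n = ∏ p ∈ n.primeFactors, (p - 1) := by
  have h := Nat.totient_mul_prod_primeFactors n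
  rw [Nat.prod_primeFactors_of_squarefree hn, mul_comm] at h
  exact Nat.eq_of_mul_eq_mul_left (Nat.pos_of_ne_zero hn.ne_zero) h

theorem stmt_4 (n : ℕ) (hodd : Odd n) (hsqf : Squarefree n) (hcomp : ¬ n.Prime)
    (hn : 4 ≤ n)
    (hdvd : (∏ p ∈ n.primeFactors, (p - 2)) ∣ Nat.totient n - 1)
    (hM : 3 ≤ (Nat.totient n - 1) / ∏ p ∈ n.primeFactors, (p - 2))
    (hbig : ∀ p : ℕ, p.Prime → p ∣ n → 11 ≤ p) :
    n.minFac ≤ n.primeFactors.card := by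
  by_contra! hlt
  have hmin : 11 ≤ n.minFac := hbig _ (Nat.minFac_prime (by omega)) (Nat.minFac_dvd n)
  have hbound := mul_prod_sub_one_le_add_card_mul_prod_sub_two (n.minFac - 2) n.primeFactors
    fun q hq => by
      have := Nat.minFac_le_of_dvd (Nat.prime_of_mem_primeFactors hq).two_le
        (Nat.dvd_of_mem_primeFactors hq)
      omega
  rw [← hsqf.totient_eq_prod_primeFactors] at hbound
  have hpos : 0 < ∏ p ∈ n.primeFactors, (p - 2) := Finset.prod_pos fun q hq => by
    have := hbig q (Nat.prime_of_mem_primeFactors hq) (Nat.dvd_of_mem_primeFactors hq)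
    omega
  rw [Nat.le_div_iff_mul_le hpos] at hM
  have htot : 3 * ∏ p ∈ n.primeFactors, (p - 2) ≤ Nat.totient n := by omega
  have hcard : n.minFac - 2 + n.primeFactors.card < (n.minFac - 2) * 3 := by omega
  have := Nat.mul_lt_mul_of_pos_right hcard hpos
  have := Nat.mul_le_mul_left (n.minFac - 2) htot
  rw [← mul_assoc] at this
  omega
end

section
/- Let n be an odd, squarefree, composite integer with n ≥ 4 such that φ(n) − 1 = M · ∏_{p ∣ n} (p − 2) for a positive integer M ≥ 2, where the product runs over the distinct prime divisors of n and φ is Euler's totient function. Then no prime divisor p of n satisfies p ≡ 1 (mod M). -/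
theorem stmt_5 (n M : ℕ) (hodd : Odd n) (hsqf : Squarefree n) (hcomp : ¬ n.Prime)
    (hn : 4 ≤ n) (hM : 2 ≤ M)
    (h : Nat.totient n - 1 = M * ∏ p ∈ n.primeFactors, (p - 2)) :
    ∀ p : ℕ, p.Prime → p ∣ n → ¬ (p % M = 1) := by
  intro p hp hpn hmod
  have hdvd : M ∣ p - 1 := hmod ▸ Nat.dvd_sub_mod p
  have htot : M ∣ n.totient :=
    hdvd.trans (Nat.totient_prime hp ▸ Nat.totient_dvd_of_dvd hpn)
  have hpos : 0 < n.totient := Nat.totient_pos.2 (by omega)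
  have hone : M ∣ 1 := (Nat.dvd_sub_iff_right hpos htot).1 ⟨_, h⟩
  have := Nat.le_of_dvd one_pos hone
  omega
end

section
/- Let n be an odd, squarefree, composite integer with n ≥ 4 such that (∏_{p ∣ n} (p − 2)) divides φ(n) − 1, where the product runs over the distinct prime divisors of n and φ is Euler's totient function, and assume M := (φ(n) − 1)/∏_{p ∣ n}(p − 2) ≥ 3. If n has at most 16 distinct prime divisors, i.e., ω(n) ≤ 16, then M = 3, that is, φ(n) − 1 = 3 · ∏_{p ∣ n}(p − 2). -/
theorem Finset.prod_le_prod_of_forall_notMem_le {s T : Finset ℕ} {f : ℕ → ℝ} {c : ℝ}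
    (hc : 1 ≤ c) (hcard : s.card ≤ T.card) (hT : ∀ p ∈ T, c ≤ f p)
    (hs : ∀ p ∈ s, p ∉ T → 0 ≤ f p ∧ f p ≤ c) :
    ∏ p ∈ s, f p ≤ ∏ p ∈ T, f p := by
  have h₁ : ∏ p ∈ s \ T, f p ≤ c ^ (s \ T).card := by
    rw [← Finset.prod_const]
    refine Finset.prod_le_prod (fun p hp => ?_) (fun p hp => ?_) <;> rw [Finset.mem_sdiff] at hp
    exacts [(hs p hp.1 hp.2).1, (hs p hp.1 hp.2).2]
  have h₂ : c ^ (T \ s).card ≤ ∏ p ∈ T \ s, f p := by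
    rw [← Finset.prod_const]
    exact Finset.prod_le_prod (fun p _ => by linarith)
      fun p hp => hT p (Finset.mem_sdiff.1 hp).1
  have h₃ : (s \ T).card ≤ (T \ s).card := by
    have h := Finset.card_sdiff_add_card_inter s T
    have h' := Finset.card_sdiff_add_card_inter T s
    rw [Finset.inter_comm] at h'
    omega
  have h₀ : 0 ≤ ∏ p ∈ T ∩ s, f p :=
    Finset.prod_nonneg fun p hp => by linarith [hT p (Finset.mem_inter.1 hp).1]
  rw [← Finset.prod_inter_mul_prod_sdiff s T, ← Finset.prod_inter_mul_prod_sdiff T s,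
    Finset.inter_comm s T]
  exact mul_le_mul_of_nonneg_left (h₁.trans ((pow_le_pow_right₀ hc h₃).trans h₂)) h₀

theorem Nat.totient_eq_prod_primeFactors_sub_one {n : ℕ} (h : Squarefree n) :
    Nat.totient n = ∏ p ∈ n.primeFactors, (p - 1) := by
  have h₁ := Nat.totient_mul_prod_primeFactors n
  rw [Nat.prod_primeFactors_of_squarefree h, mul_comm] at h₁
  exact Nat.eq_of_mul_eq_mul_left (Nat.pos_of_ne_zero h.ne_zero) h₁

theorem prod_sub_one_lt_five_mul {s T : Finset ℕ} {m : ℕ} (hm : 3 ≤ m)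
    (hcard : s.card ≤ T.card) (h3 : ∀ p ∈ s, 3 ≤ p) (hT : ∀ p ∈ T, 3 ≤ p ∧ p ≤ m)
    (hs : ∀ p ∈ s, p ∉ T → m ≤ p) (hprod : ∏ p ∈ T, (1 + 1 / ((p : ℝ) - 2)) < 5) :
    ∏ p ∈ s, (p - 1) < 5 * ∏ p ∈ s, (p - 2) := by
  have hm' : (3 : ℝ) ≤ m := by exact_mod_cast hm
  have key := Finset.prod_le_prod_of_forall_notMem_le (s := s) (T := T)
    (f := fun p : ℕ => 1 + 1 / ((p : ℝ) - 2)) (c := 1 + 1 / ((m : ℝ) - 2))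
    (by
      have : 0 ≤ 1 / ((m : ℝ) - 2) := one_div_nonneg.2 (by linarith)
      linarith) hcard
    (fun p hp => by
      have h : (3 : ℝ) ≤ p := by exact_mod_cast (hT p hp).1
      have h' : (p : ℝ) ≤ m := by exact_mod_cast (hT p hp).2
      have := one_div_le_one_div_of_le (show (0 : ℝ) < p - 2 by linarith)
        (show (p : ℝ) - 2 ≤ m - 2 by linarith)
      linarith)
    (fun p hp hpT => by
      have h : (m : ℝ) ≤ p := by exact_mod_cast hs p hp hpT
      have := one_div_le_one_div_of_le (show (0 : ℝ) < m - 2 by linarith)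
        (show (m : ℝ) - 2 ≤ p - 2 by linarith)
      have h0 : 0 ≤ 1 / ((p : ℝ) - 2) := one_div_nonneg.2 (by linarith)
      exact ⟨by linarith, by linarith⟩)
  have hpos : (0 : ℝ) < ∏ p ∈ s, ((p : ℝ) - 2) := Finset.prod_pos fun p hp => by
    have h : (3 : ℝ) ≤ p := by exact_mod_cast h3 p hp
    linarith
  have hmul : (∏ p ∈ s, (1 + 1 / ((p : ℝ) - 2))) * ∏ p ∈ s, ((p : ℝ) - 2)
      = ∏ p ∈ s, ((p : ℝ) - 1) := by
    rw [← Finset.prod_mul_distrib]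
    refine Finset.prod_congr rfl fun p hp => ?_
    have h : (3 : ℝ) ≤ p := by exact_mod_cast h3 p hp
    have h' : (p : ℝ) - 2 ≠ 0 := by linarith
    field_simp
    ring
  have hcast (k : ℕ) (hk : k ≤ 3) :
      ((∏ p ∈ s, (p - k) : ℕ) : ℝ) = ∏ p ∈ s, ((p : ℝ) - k) := by
    rw [Nat.cast_prod]
    exact Finset.prod_congr rfl fun p hp => Nat.cast_sub (hk.trans (h3 p hp))
  have h1 := hcast 1 (by norm_num)
  have h2 := hcast 2 (by norm_num)
  push_cast at h1 h2
  have : ((∏ p ∈ s, (p - 1) : ℕ) : ℝ) < ((5 * ∏ p ∈ s, (p - 2) : ℕ) : ℝ) := by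
    push_cast
    rw [h1, h2, ← hmul]
    exact mul_lt_mul_of_pos_right (key.trans_lt hprod) hpos
  exact_mod_cast this

set_option maxRecDepth 100000 in
theorem stmt_8 (n : ℕ) (hodd : Odd n) (hsqf : Squarefree n) (hcomp : ¬ n.Prime)
    (hn : 4 ≤ n)
    (hdvd : (∏ p ∈ n.primeFactors, (p - 2)) ∣ Nat.totient n - 1)
    (hM : 3 ≤ (Nat.totient n - 1) / ∏ p ∈ n.primeFactors, (p - 2))
    (hω : n.primeFactors.card ≤ 16) :
    Nat.totient n - 1 = 3 * ∏ p ∈ n.primeFactors, (p - 2) := by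
  have hprime : ∀ p ∈ n.primeFactors, p.Prime := fun p hp => Nat.prime_of_mem_primeFactors hp
  have h3 : ∀ p ∈ n.primeFactors, 3 ≤ p := fun p hp => by
    have h2 := (hprime p hp).two_le
    have hpo : Odd p := hodd.of_dvd_nat (Nat.dvd_of_mem_primeFactors hp)
    obtain ⟨k, rfl⟩ := hpo
    omega
  have hsmall : ∀ p ∈ n.primeFactors, ∀ r ∈ [2, 3, 5, 7], p % r = 0 → p = r := by
    intro p hp r hr h
    refine ((hprime p hp).eq_one_or_self_of_dvd r (Nat.dvd_of_mod_eq_zero h)).elim ?_ Eq.symm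
    rintro rfl
    simp at hr
  have htot := Nat.totient_eq_prod_primeFactors_sub_one hsqf
  have heven : Even n.totient := Nat.totient_even (by omega)
  have htpos : 0 < n.totient := Nat.totient_pos.2 (by omega)
  have hlt : n.totient < 5 * ∏ p ∈ n.primeFactors, (p - 2) := by
    rw [htot]
    by_cases h5 : 5 ∈ n.primeFactors
    · have hmod : ∀ p ∈ n.primeFactors, p % 3 ≠ 1 := fun p hp hp1 => by
        have h₁ : 3 ∣ n.totient := by
          rw [htot]
          exact (show 3 ∣ p - 1 by omega).trans (Finset.dvd_prod_of_mem (fun p => p - 1) hp)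
        have h₂ : 3 ∣ n.totient - 1 :=
          (Finset.dvd_prod_of_mem (fun p => p - 2) h5).trans hdvd
        omega
      refine prod_sub_one_lt_five_mul (m := 113)
        (T := {3, 5, 11, 17, 23, 29, 41, 47, 53, 59, 71, 83, 89, 101, 107, 113})
        (by norm_num) (hω.trans (by decide)) h3 (by decide) (fun p hp hpT => ?_) (by norm_num)
      by_contra! hlt
      have hall : ∀ q < 113, (∀ r ∈ [2, 3, 5, 7], q % r = 0 → q = r) → 3 ≤ q → q % 3 ≠ 1 →
          q ∈ ({3, 5, 11, 17, 23, 29, 41, 47, 53, 59, 71, 83, 89, 101, 107, 113} : Finset ℕ) := by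
        decide
      exact hpT (hall p hlt (hsmall p hp) (h3 p hp) (hmod p hp))
    · refine prod_sub_one_lt_five_mul (m := 61)
        (T := {3, 7, 11, 13, 17, 19, 23, 29, 31, 37, 41, 43, 47, 53, 59, 61})
        (by norm_num) (hω.trans (by decide)) h3 (by decide) (fun p hp hpT => ?_) (by norm_num)
      by_contra! hlt
      have hall : ∀ q < 61, (∀ r ∈ [2, 3, 5, 7], q % r = 0 → q = r) → 3 ≤ q → q ≠ 5 →
          q ∈ ({3, 7, 11, 13, 17, 19, 23, 29, 31, 37, 41, 43, 47, 53, 59, 61} : Finset ℕ) := by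
        decide
      exact hpT (hall p hlt (hsmall p hp) (h3 p hp) fun h => h5 (h ▸ hp))
  obtain ⟨k, hk⟩ := hdvd
  have hS : 0 < ∏ p ∈ n.primeFactors, (p - 2) :=
    Finset.prod_pos fun p hp => Nat.sub_pos_of_lt (h3 p hp)
  rw [hk, Nat.mul_div_cancel_left _ hS] at hM
  have hk5 : k < 5 := lt_of_mul_lt_mul_left
    (show (∏ p ∈ n.primeFactors, (p - 2)) * k < (∏ p ∈ n.primeFactors, (p - 2)) * 5 by omega)
    (Nat.zero_le _)
  have hk4 : k ≠ 4 := by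
    rintro rfl
    obtain ⟨j, hj⟩ := heven
    omega
  obtain rfl : k = 3 := by omega
  rw [hk, mul_comm]
end
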